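/- arXiv:2603.16988 — 4 statements merged into one kernel-verified Lean document; each statement's English description precedes it below -/
import Mathlib

section
/- Let n ≥ 1 with 3 ∣ n, set ζ = exp(2πi/n) and ω = ζ^{n/3}. Let v = (ζ^a, ζ^b, ζ^c) and w = (ζ^d, ζ^e, ζ^f) be vectors in ℂ³ with all coordinates n-th roots of unity. If the Hermitian inner product ⟨v,w⟩ = Σ_k conj(v_k)·w_k vanishes, then w is a nonzero complex scalar multiple of w₊ = (ζ^a, ω·ζ^b, ω²·ζ^c) or of w₋ = (ζ^a, ω²·ζ^b, ω·ζ^c). -/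
open Complex

noncomputable def zeta (n : ℕ) : ℂ := Complex.exp (2 * Real.pi * Complex.I / n)

noncomputable def hermInner (v w : Fin 3 → ℂ) : ℂ :=
  ∑ k, (starRingEnd ℂ) (v k) * w k

theorem zeta_isPrimitiveRoot {n : ℕ} (hn : n ≠ 0) : IsPrimitiveRoot (zeta n) n :=
  Complex.isPrimitiveRoot_exp n hn

theorem norm_zeta_zpow {n : ℕ} (hn : n ≠ 0) (k : ℤ) : ‖zeta n ^ k‖ = 1 := by
  rw [norm_zpow, (zeta_isPrimitiveRoot hn).norm'_eq_one hn, one_zpow]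

theorem zeta_pow_div_three {n : ℕ} (hn : n ≠ 0) (h3 : 3 ∣ n) :
    1 + zeta n ^ (n / 3) + (zeta n ^ (n / 3)) ^ 2 = 0 := by
  have h : IsPrimitiveRoot (zeta n ^ (n / 3)) 3 :=
    (zeta_isPrimitiveRoot hn).pow (Nat.pos_of_ne_zero hn) (Nat.div_mul_cancel h3).symm
  simpa [Finset.sum_range_succ] using h.geom_sum_eq_zero (by norm_num)

/-- Three complex numbers of norm one with zero sum form an equilateral triangle. -/
theorem eq_rotations_of_add_eq_zero {p q r w : ℂ} (hp : ‖p‖ = 1) (hq : ‖q‖ = 1) (hr : ‖r‖ = 1)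
    (hw : 1 + w + w ^ 2 = 0) (h : p + q + r = 0) :
    (q = w * p ∧ r = w ^ 2 * p) ∨ (q = w ^ 2 * p ∧ r = w * p) := by
  have hconj : p⁻¹ + q⁻¹ + r⁻¹ = 0 := by
    rw [Complex.inv_eq_conj hp, Complex.inv_eq_conj hq, Complex.inv_eq_conj hr,
      ← map_add, ← map_add, h, map_zero]
  have hp0 : p ≠ 0 := norm_ne_zero_iff.mp (by simp [hp])
  have hq0 : q ≠ 0 := norm_ne_zero_iff.mp (by simp [hq])
  have hr0 : r ≠ 0 := norm_ne_zero_iff.mp (by simp [hr])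
  have hpairs : q * r + p * r + p * q = 0 := by
    field_simp at hconj
    linear_combination hconj
  have hfactor : (q - w * p) * (q - w ^ 2 * p) = 0 := by
    linear_combination (p + q) * h - hpairs + (p ^ 2 * (w - 1) - p * q) * hw
  rcases mul_eq_zero.mp hfactor with hq' | hq'
  · exact Or.inl ⟨sub_eq_zero.mp hq', by linear_combination h - hq' - p * hw⟩
  · exact Or.inr ⟨sub_eq_zero.mp hq', by linear_combination h - hq' - p * hw⟩

/-- Projective collapse: if v, w are all-nonzero root-of-unity vectors with
vanishing Hermitian inner product, then w is a scalar multiple of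
w₊ = (ζ^a, ωζ^b, ω²ζ^c) or of w₋ = (ζ^a, ω²ζ^b, ωζ^c), where ω = ζ^(n/3). -/
theorem stmt4 (n : ℕ) (hn : 1 ≤ n) (h3 : 3 ∣ n) (a b c d e f : ℤ)
    (horth : hermInner ![zeta n ^ a, zeta n ^ b, zeta n ^ c]
                       ![zeta n ^ d, zeta n ^ e, zeta n ^ f] = 0) :
    ∃ lam : ℂ, lam ≠ 0 ∧
      ((![zeta n ^ d, zeta n ^ e, zeta n ^ f] : Fin 3 → ℂ) =
         lam • ![zeta n ^ a, zeta n ^ (n / 3) * zeta n ^ b,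
                 (zeta n ^ (n / 3)) ^ 2 * zeta n ^ c] ∨
       (![zeta n ^ d, zeta n ^ e, zeta n ^ f] : Fin 3 → ℂ) =
         lam • ![zeta n ^ a, (zeta n ^ (n / 3)) ^ 2 * zeta n ^ b,
                 zeta n ^ (n / 3) * zeta n ^ c]) := by
  have hn0 : n ≠ 0 := Nat.one_le_iff_ne_zero.mp hn
  have hne (k : ℤ) : zeta n ^ k ≠ 0 := norm_ne_zero_iff.mp (by simp [norm_zeta_zpow hn0])
  have hconj (k : ℤ) : (starRingEnd ℂ) (zeta n ^ k) = (zeta n ^ k)⁻¹ :=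
    (Complex.inv_eq_conj (norm_zeta_zpow hn0 k)).symm
  have hnorm (k l : ℤ) : ‖(zeta n ^ k)⁻¹ * zeta n ^ l‖ = 1 := by
    rw [norm_mul, norm_inv, norm_zeta_zpow hn0, norm_zeta_zpow hn0, inv_one, one_mul]
  have hsum : (zeta n ^ a)⁻¹ * zeta n ^ d + (zeta n ^ b)⁻¹ * zeta n ^ e +
      (zeta n ^ c)⁻¹ * zeta n ^ f = 0 := by
    rw [← hconj, ← hconj, ← hconj]
    rwa [hermInner, Fin.sum_univ_three] at horth
  have hsplit {k l : ℤ} {s t : ℂ} (h : (zeta n ^ k)⁻¹ * zeta n ^ l = s * t) :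
      zeta n ^ l = t * (s * zeta n ^ k) := by
    rw [inv_mul_eq_iff_eq_mul₀ (hne k)] at h
    rw [h]
    ring
  have hd : zeta n ^ d = (zeta n ^ a)⁻¹ * zeta n ^ d * zeta n ^ a := by
    rw [mul_right_comm, inv_mul_cancel₀ (hne a), one_mul]
  refine ⟨(zeta n ^ a)⁻¹ * zeta n ^ d, mul_ne_zero (inv_ne_zero (hne a)) (hne d), ?_⟩
  refine (eq_rotations_of_add_eq_zero (hnorm a d) (hnorm b e) (hnorm c f)
    (zeta_pow_div_three hn0 h3) hsum).imp ?_ ?_ <;>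
  · rintro ⟨he, hf⟩
    ext i
    fin_cases i
    exacts [hd, hsplit he, hsplit hf]
end

section
/- If n ≥ 1 is coprime to 6, then the only triad in the n-th root-of-unity ray pool P_n is the axis triad {[(1,0,0)], [(0,1,0)], [(0,0,1)]}, and P_n admits a KS coloring. -/
open Complex

abbrev Ray3 := Projectivization ℂ (Fin 3 → ℂ)

/-- Orthogonality of rays, tested on canonical representatives; this is
independent of the choice of representative since the Hermitian inner
product scales by nonzero factors. -/
def RayOrtho (x y : Ray3) : Prop := hermInner x.rep y.rep = 0

/-- The n-th root-of-unity ray pool: rays admitting a representative all of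
whose coordinates lie in {0} ∪ {ζ^k : 0 ≤ k < n}. -/
def pool (n : ℕ) : Set Ray3 :=
  {x | ∃ (v : Fin 3 → ℂ) (hv : v ≠ 0), Projectivization.mk ℂ v hv = x ∧
    ∀ k, v k = 0 ∨ ∃ j : ℕ, j < n ∧ v k = zeta n ^ j}

/-- A KS coloring of a set `S` of rays: (a) orthogonal exclusion; (b) every
triad contained in `S` has exactly one element colored `true`. -/
def IsKSColoring (S : Set Ray3) (f : Ray3 → Bool) : Prop :=
  (∀ v ∈ S, ∀ w ∈ S, RayOrtho v w → f v = true → f w = false) ∧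
  (∀ a ∈ S, ∀ b ∈ S, ∀ c ∈ S, a ≠ b → a ≠ c → b ≠ c →
    RayOrtho a b → RayOrtho a c → RayOrtho b c →
      ((f a = true ∧ f b = false ∧ f c = false) ∨
       (f a = false ∧ f b = true ∧ f c = false) ∨
       (f a = false ∧ f b = false ∧ f c = true)))

def KSUncolorable (S : Set Ray3) : Prop := ¬ ∃ f : Ray3 → Bool, IsKSColoring S f

/-- The triads of a set of rays: three-element sets of pairwise orthogonal rays. -/
def TriadsOf (S : Set Ray3) : Set (Set Ray3) :=
  {T | ∃ a b c : Ray3, T = {a, b, c} ∧ a ∈ S ∧ b ∈ S ∧ c ∈ S ∧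
    a ≠ b ∧ a ≠ c ∧ b ≠ c ∧ RayOrtho a b ∧ RayOrtho a c ∧ RayOrtho b c}

noncomputable def e0 : Ray3 := Projectivization.mk ℂ ![1, 0, 0] (by
  intro h; simpa using congrFun h 0)

noncomputable def e1 : Ray3 := Projectivization.mk ℂ ![0, 1, 0] (by
  intro h; simpa using congrFun h 1)

noncomputable def e2 : Ray3 := Projectivization.mk ℂ ![0, 0, 1] (by
  intro h; simpa using congrFun h 2)

lemma eq_of_pow_three_eq {n : ℕ} (h3 : Nat.Coprime n 3) {a b : ℂ}
    (ha : a ^ n = 1) (hb : b ^ n = 1) (hb0 : b ≠ 0) (h : a ^ 3 = b ^ 3) : a = b := by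
  have h1 : (a / b) ^ n = 1 := by rw [div_pow, ha, hb, div_one]
  have h2 : (a / b) ^ 3 = 1 := by rw [div_pow, h, div_self (pow_ne_zero 3 hb0)]
  have h4 : (a / b) ^ n.gcd 3 = 1 := pow_gcd_eq_one.mpr ⟨h1, h2⟩
  rw [h3, pow_one] at h4
  exact (div_eq_one_iff_eq hb0).mp h4

lemma add_ne_zero_of_pow_odd {n : ℕ} (hodd : Odd n) {a b : ℂ}
    (ha : a ^ n = 1) (hb : b ^ n = 1) : a + b ≠ 0 := by
  intro h
  rw [eq_neg_of_add_eq_zero_left h, hodd.neg_pow, hb] at ha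
  norm_num at ha

lemma add_add_ne_zero_of_pow {n : ℕ} (hn : n ≠ 0) (h3 : Nat.Coprime n 3) {a b c : ℂ}
    (ha : a ^ n = 1) (hb : b ^ n = 1) (hc : c ^ n = 1) : a + b + c ≠ 0 := by
  intro h
  have conj_mul {z : ℂ} (hz : z ^ n = 1) : (starRingEnd ℂ) z * z = 1 := by
    rw [Complex.conj_mul', Complex.norm_eq_one_of_pow_eq_one hz hn]
    norm_num
  have ne_zero {z : ℂ} (hz : z ^ n = 1) : z ≠ 0 := by
    rintro rfl
    simp [hn] at hz
  have hconj : (starRingEnd ℂ) a + (starRingEnd ℂ) b + (starRingEnd ℂ) c = 0 := by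
    rw [← map_add, ← map_add, h, map_zero]
  have hsym : a * b + b * c + c * a = 0 := by
    linear_combination a * b * c * hconj - b * c * conj_mul ha - a * c * conj_mul hb -
      a * b * conj_mul hc
  have hab : a = b := eq_of_pow_three_eq h3 ha hb (ne_zero hb) <| by
    linear_combination (a ^ 2 - b ^ 2) * h - (a - b) * hsym
  have hac : a = c := eq_of_pow_three_eq h3 ha hc (ne_zero hc) <| by
    linear_combination (a ^ 2 - c ^ 2) * h - (a - c) * hsym
  subst hab hac
  apply ne_zero ha
  linear_combination h / 3

lemma eq_zero_of_sum_eq_zero {n : ℕ} (hn : n ≠ 0) (hcop : Nat.Coprime n 6) {u : Fin 3 → ℂ}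
    (hu : ∀ k, u k = 0 ∨ u k ^ n = 1) (hsum : ∑ k, u k = 0) (k : Fin 3) : u k = 0 := by
  have hodd : Odd n := Nat.coprime_two_right.mp (hcop.coprime_dvd_right (by norm_num))
  have h3 : Nat.Coprime n 3 := hcop.coprime_dvd_right (by norm_num)
  rw [Fin.sum_univ_three] at hsum
  have key : u 0 = 0 ∧ u 1 = 0 ∧ u 2 = 0 := by
    rcases hu 0 with h0 | h0 <;> rcases hu 1 with h1 | h1 <;> rcases hu 2 with h2 | h2
    · exact ⟨h0, h1, h2⟩
    · simp_all
    · simp_all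
    · exact absurd (by simpa [h0] using hsum) (add_ne_zero_of_pow_odd hodd h1 h2)
    · simp_all
    · exact absurd (by simpa [h1] using hsum) (add_ne_zero_of_pow_odd hodd h0 h2)
    · exact absurd (by simpa [h2] using hsum) (add_ne_zero_of_pow_odd hodd h0 h1)
    · exact absurd hsum (add_add_ne_zero_of_pow hn h3 h0 h1 h2)
  fin_cases k
  exacts [key.1, key.2.1, key.2.2]

lemma zeta_pow_self {n : ℕ} (hn : n ≠ 0) : zeta n ^ n = 1 :=
  (Complex.isPrimitiveRoot_exp n hn).pow_eq_one

lemma hermInner_smul (a b : ℂ) (v w : Fin 3 → ℂ) :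
    hermInner (a • v) (b • w) = (starRingEnd ℂ) a * b * hermInner v w := by
  simp only [hermInner, Pi.smul_apply, smul_eq_mul, map_mul, Finset.mul_sum]
  exact Finset.sum_congr rfl fun _ _ => by ring

lemma hermInner_eq_zero_of_disjoint {v w : Fin 3 → ℂ} (h : ∀ k, v k = 0 ∨ w k = 0) :
    hermInner v w = 0 :=
  Finset.sum_eq_zero fun k _ => by rcases h k with h | h <;> simp [h]

open scoped ComplexOrder in
lemma not_rayOrtho_self (x : Ray3) : ¬ RayOrtho x x := by
  intro h
  have h' : star x.rep ⬝ᵥ x.rep = 0 := h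
  exact x.rep_nonzero (dotProduct_star_self_eq_zero.mp h')

/-- In the pool for `n` coprime to 6, orthogonal rays have disjoint supports. -/
lemma rep_eq_zero_or_of_rayOrtho {n : ℕ} (hn : n ≠ 0) (hcop : Nat.Coprime n 6) {x y : Ray3}
    (hx : x ∈ pool n) (hy : y ∈ pool n) (h : RayOrtho x y) (k : Fin 3) :
    x.rep k = 0 ∨ y.rep k = 0 := by
  obtain ⟨v, hv, rfl, hvk⟩ := hx
  obtain ⟨w, hw, rfl, hwk⟩ := hy
  obtain ⟨a, ha⟩ := Projectivization.exists_smul_eq_mk_rep ℂ v hv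
  obtain ⟨b, hb⟩ := Projectivization.exists_smul_eq_mk_rep ℂ w hw
  rw [Units.smul_def] at ha hb
  have hvw : hermInner v w = 0 := by
    rw [RayOrtho, ← ha, ← hb, hermInner_smul] at h
    simpa using h
  have pow_one_of {z : ℂ} (hz : z = 0 ∨ ∃ j : ℕ, j < n ∧ z = zeta n ^ j) :
      z = 0 ∨ z ^ n = 1 :=
    hz.imp_right fun ⟨j, _, hj⟩ => by rw [hj, pow_right_comm, zeta_pow_self hn, one_pow]
  have hterm := eq_zero_of_sum_eq_zero hn hcop (fun k => by
    rcases pow_one_of (hvk k) with h1 | h1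
    · simp [h1]
    rcases pow_one_of (hwk k) with h2 | h2
    · simp [h2]
    right
    rw [mul_pow, ← map_pow, h1, h2, map_one, one_mul]) hvw k
  rw [← ha, ← hb]
  simpa using hterm

/-- The coordinate axis spanned by the `i`-th standard basis vector. -/
noncomputable def axis (i : Fin 3) : Ray3 :=
  Projectivization.mk ℂ (Pi.single i 1) (by simp)

lemma e0_eq_axis : e0 = axis 0 := by
  unfold e0 axis; congr 1; ext k; fin_cases k <;> simp

lemma e1_eq_axis : e1 = axis 1 := by
  unfold e1 axis; congr 1; ext k; fin_cases k <;> simp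

lemma e2_eq_axis : e2 = axis 2 := by
  unfold e2 axis; congr 1; ext k; fin_cases k <;> simp

lemma axis_mem_pool {n : ℕ} (hn : n ≠ 0) (i : Fin 3) : axis i ∈ pool n := by
  refine ⟨_, _, rfl, fun k => ?_⟩
  rcases eq_or_ne k i with rfl | h
  · exact Or.inr ⟨0, Nat.pos_of_ne_zero hn, by simp⟩
  · exact Or.inl (by simp [h])

lemma rayOrtho_axis {i j : Fin 3} (h : i ≠ j) : RayOrtho (axis i) (axis j) := by
  obtain ⟨a, ha⟩ := Projectivization.exists_smul_eq_mk_rep ℂ (Pi.single i 1 : Fin 3 → ℂ) (by simp)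
  obtain ⟨b, hb⟩ := Projectivization.exists_smul_eq_mk_rep ℂ (Pi.single j 1 : Fin 3 → ℂ) (by simp)
  rw [Units.smul_def] at ha hb
  rw [RayOrtho, axis, axis, ← ha, ← hb, hermInner_smul, hermInner_eq_zero_of_disjoint, mul_zero]
  intro k
  rcases eq_or_ne k i with rfl | hk
  · simp [h]
  · simp [hk]

lemma axis_injective : Function.Injective axis := by
  intro i j h
  by_contra hij
  have := rayOrtho_axis hij
  rw [h] at this
  exact not_rayOrtho_self _ this

lemma eq_axis_of_rep {x : Ray3} {i : Fin 3} (h : ∀ k, k ≠ i → x.rep k = 0) : x = axis i := by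
  rw [← x.mk_rep, axis, Projectivization.mk_eq_mk_iff']
  refine ⟨x.rep i, ?_⟩
  ext k
  rcases eq_or_ne k i with rfl | hk
  · simp
  · simp [hk, h k hk]

/-- Three pairwise orthogonal rays of the pool are the three coordinate axes. -/
lemma exists_perm_axis {n : ℕ} (hn : n ≠ 0) (hcop : Nat.Coprime n 6) {a b c : Ray3}
    (ha : a ∈ pool n) (hb : b ∈ pool n) (hc : c ∈ pool n)
    (hab : RayOrtho a b) (hac : RayOrtho a c) (hbc : RayOrtho b c) :
    ∃ i j k : Fin 3, i ≠ j ∧ i ≠ k ∧ j ≠ k ∧ a = axis i ∧ b = axis j ∧ c = axis k := by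
  have dab := rep_eq_zero_or_of_rayOrtho hn hcop ha hb hab
  have dac := rep_eq_zero_or_of_rayOrtho hn hcop ha hc hac
  have dbc := rep_eq_zero_or_of_rayOrtho hn hcop hb hc hbc
  obtain ⟨i, hi⟩ := Function.ne_iff.mp a.rep_nonzero
  obtain ⟨j, hj⟩ := Function.ne_iff.mp b.rep_nonzero
  obtain ⟨k, hk⟩ := Function.ne_iff.mp c.rep_nonzero
  rw [Pi.zero_apply] at hi hj hk
  have hij : i ≠ j := by
    rintro rfl
    exact (dab i).elim hi hj
  have hik : i ≠ k := by
    rintro rfl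
    exact (dac i).elim hi hk
  have hjk : j ≠ k := by
    rintro rfl
    exact (dbc j).elim hj hk
  have cover (l : Fin 3) : l = i ∨ l = j ∨ l = k := by omega
  refine ⟨i, j, k, hij, hik, hjk, eq_axis_of_rep fun l hl => ?_, eq_axis_of_rep fun l hl => ?_,
    eq_axis_of_rep fun l hl => ?_⟩
  · rcases cover l with rfl | rfl | rfl
    · exact absurd rfl hl
    · exact (dab l).resolve_right hj
    · exact (dac l).resolve_right hk
  · rcases cover l with rfl | rfl | rfl
    · exact (dab l).resolve_left hi
    · exact absurd rfl hl
    · exact (dbc l).resolve_right hk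
  · rcases cover l with rfl | rfl | rfl
    · exact (dac l).resolve_left hi
    · exact (dbc l).resolve_left hj
    · exact absurd rfl hl

lemma axis_set_eq {i j k : Fin 3} (hij : i ≠ j) (hik : i ≠ k) (hjk : j ≠ k) :
    ({axis i, axis j, axis k} : Set Ray3) = {axis 0, axis 1, axis 2} := by
  have h : ({i, j, k} : Set (Fin 3)) = {0, 1, 2} := by
    ext l
    simp only [Set.mem_insert_iff, Set.mem_singleton_iff]
    omega
  simpa [Set.image_insert_eq] using congrArg (axis '' ·) h

/-- If n is coprime to 6, the only triad of the n-th root-of-unity pool is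
the axis triad, and the pool admits a KS coloring. -/
theorem stmt9 (n : ℕ) (hn : 1 ≤ n) (hcop : Nat.Coprime n 6) :
    TriadsOf (pool n) = {({e0, e1, e2} : Set Ray3)} ∧
    ∃ f : Ray3 → Bool, IsKSColoring (pool n) f := by
  classical
  have hn0 : n ≠ 0 := by omega
  constructor
  · rw [e0_eq_axis, e1_eq_axis, e2_eq_axis]
    ext T
    rw [Set.mem_singleton_iff]
    constructor
    · rintro ⟨a, b, c, rfl, ha, hb, hc, -, -, -, hab, hac, hbc⟩
      obtain ⟨i, j, k, hij, hik, hjk, rfl, rfl, rfl⟩ :=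
        exists_perm_axis hn0 hcop ha hb hc hab hac hbc
      exact axis_set_eq hij hik hjk
    · rintro rfl
      exact ⟨_, _, _, rfl, axis_mem_pool hn0 0, axis_mem_pool hn0 1, axis_mem_pool hn0 2,
        axis_injective.ne (by decide), axis_injective.ne (by decide),
        axis_injective.ne (by decide), rayOrtho_axis (by decide), rayOrtho_axis (by decide),
        rayOrtho_axis (by decide)⟩
  · refine ⟨fun x => decide (x = axis 0), ?_, ?_⟩
    · intro v _ w _ hvw hv
      simp only [decide_eq_true_eq, decide_eq_false_iff_not] at hv ⊢
      rintro rfl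
      exact not_rayOrtho_self _ (hv ▸ hvw)
    · intro a ha b hb c hc _ _ _ hab hac hbc
      obtain ⟨i, j, k, hij, hik, hjk, rfl, rfl, rfl⟩ :=
        exists_perm_axis hn0 hcop ha hb hc hab hac hbc
      simp only [decide_eq_true_eq, decide_eq_false_iff_not, axis_injective.eq_iff]
      omega
end

section
/- The 6-th root-of-unity ray pool P_6 in ℂ³ is KS-uncolorable. -/
open Complex

theorem rayOrtho_mk_iff {v w : Fin 3 → ℂ} (hv : v ≠ 0) (hw : w ≠ 0) :
    RayOrtho (Projectivization.mk ℂ v hv) (Projectivization.mk ℂ w hw) ↔ hermInner v w = 0 := by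
  obtain ⟨a, ha⟩ := Projectivization.exists_smul_eq_mk_rep ℂ v hv
  obtain ⟨b, hb⟩ := Projectivization.exists_smul_eq_mk_rep ℂ w hw
  have h : hermInner (a • v) (b • w) = (starRingEnd ℂ) (a : ℂ) * b * hermInner v w := by
    simp only [hermInner, Pi.smul_apply, Units.smul_def, smul_eq_mul, map_mul, Finset.mul_sum]
    exact Finset.sum_congr rfl fun _ _ => by ring
  rw [RayOrtho, ← ha, ← hb, h]
  simp

theorem hermInner_self_ne_zero {v : Fin 3 → ℂ} (hv : v ≠ 0) : hermInner v v ≠ 0 := by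
  intro h
  have h' : ((∑ k, Complex.normSq (v k) : ℝ) : ℂ) = 0 := by
    rw [← h, hermInner, Complex.ofReal_sum]
    exact Finset.sum_congr rfl fun _ _ => Complex.normSq_eq_conj_mul_self
  rw [Complex.ofReal_eq_zero, Finset.sum_eq_zero_iff_of_nonneg fun _ _ => Complex.normSq_nonneg _]
    at h'
  exact hv (funext fun k => Complex.normSq_eq_zero.1 (h' k (Finset.mem_univ k)))

theorem RayOrtho.ne {x y : Ray3} (h : RayOrtho x y) : x ≠ y := by
  rintro rfl
  exact hermInner_self_ne_zero x.rep_nonzero h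

theorem mk_mem_pool {n : ℕ} [NeZero n] {v : Fin 3 → ℂ} (hv : v ≠ 0)
    (h : ∀ k, v k = 0 ∨ v k ^ n = 1) : Projectivization.mk ℂ v hv ∈ pool n := by
  refine ⟨v, hv, rfl, fun k => (h k).imp_right fun hk => ?_⟩
  obtain ⟨j, hj, hjk⟩ :=
    (Complex.isPrimitiveRoot_exp n (NeZero.ne n)).eq_pow_of_pow_eq_one hk
  exact ⟨j, hj, hjk.symm⟩

/-- The ray spanned by `v` is colored `true`. -/
def ColoredTrue (f : Ray3 → Bool) (v : Fin 3 → ℂ) : Prop :=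
  ∃ hv : v ≠ 0, f (Projectivization.mk ℂ v hv) = true

section Coloring

variable {n : ℕ} [NeZero n] {f : Ray3 → Bool}

theorem IsKSColoring.not_coloredTrue (hf : IsKSColoring (pool n) f) {v w : Fin 3 → ℂ}
    (hv : ∀ k, v k = 0 ∨ v k ^ n = 1) (hw : ∀ k, w k = 0 ∨ w k ^ n = 1)
    (h : hermInner v w = 0) (hfv : ColoredTrue f v) : ¬ ColoredTrue f w := by
  obtain ⟨hv0, hfv⟩ := hfv
  rintro ⟨hw0, hfw⟩
  have := hf.1 _ (mk_mem_pool hv0 hv) _ (mk_mem_pool hw0 hw) ((rayOrtho_mk_iff hv0 hw0).2 h) hfv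
  simp [hfw] at this

theorem IsKSColoring.exists_coloredTrue (hf : IsKSColoring (pool n) f) {u v w : Fin 3 → ℂ}
    (hu0 : u ≠ 0) (hv0 : v ≠ 0) (hw0 : w ≠ 0)
    (hu : ∀ k, u k = 0 ∨ u k ^ n = 1) (hv : ∀ k, v k = 0 ∨ v k ^ n = 1)
    (hw : ∀ k, w k = 0 ∨ w k ^ n = 1)
    (huv : hermInner u v = 0) (huw : hermInner u w = 0) (hvw : hermInner v w = 0) :
    ColoredTrue f u ∨ ColoredTrue f v ∨ ColoredTrue f w := by
  have huv' := (rayOrtho_mk_iff hu0 hv0).2 huv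
  have huw' := (rayOrtho_mk_iff hu0 hw0).2 huw
  have hvw' := (rayOrtho_mk_iff hv0 hw0).2 hvw
  rcases hf.2 _ (mk_mem_pool hu0 hu) _ (mk_mem_pool hv0 hv) _ (mk_mem_pool hw0 hw)
    huv'.ne huw'.ne hvw'.ne huv' huw' hvw' with h | h | h
  · exact .inl ⟨hu0, h.1⟩
  · exact .inr (.inl ⟨hv0, h.2.1⟩)
  · exact .inr (.inr ⟨hw0, h.2.2⟩)

end Coloring

/-- The vector with coordinates `x`, `y`, `z` at the indices `i`, `i + 1`, `i + 2`. -/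
def cyclicVec (i : Fin 3) (x y z : ℂ) : Fin 3 → ℂ :=
  fun k => if k = i then x else if k = i + 1 then y else z

theorem hermInner_cyclicVec (i : Fin 3) (x y z x' y' z' : ℂ) :
    hermInner (cyclicVec i x y z) (cyclicVec i x' y' z') =
      (starRingEnd ℂ) x * x' + (starRingEnd ℂ) y * y' + (starRingEnd ℂ) z * z' := by
  fin_cases i <;> simp [hermInner, cyclicVec, Fin.sum_univ_three] <;> ring

theorem cyclicVec_coord {p : ℂ → Prop} (i : Fin 3) {x y z : ℂ} (hx : p x) (hy : p y) (hz : p z)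
    (k : Fin 3) : p (cyclicVec i x y z k) := by
  unfold cyclicVec
  split_ifs <;> assumption

theorem cyclicVec_ne_zero (i : Fin 3) {x y z : ℂ} (h : x ≠ 0 ∨ y ≠ 0 ∨ z ≠ 0) :
    cyclicVec i x y z ≠ 0 := by
  intro h0
  have h1 := congrFun h0 i
  have h2 := congrFun h0 (i + 1)
  have h3 := congrFun h0 (i + 2)
  fin_cases i <;> simp_all [cyclicVec]

theorem conj_mul_self_of_pow_eq_one {n : ℕ} [NeZero n] {y : ℂ} (hy : y ^ n = 1) :
    (starRingEnd ℂ) y * y = 1 := by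
  rw [Complex.conj_mul', Complex.norm_eq_one_of_pow_eq_one hy (NeZero.ne n)]
  norm_num

/-- If one of each antipodal pair of sixth roots of unity satisfies `p`, then so do two roots
differing by a factor of the cube root of unity `ω`. -/
theorem exists_and_mul_of_or_neg {p : ℂ → Prop} {ω : ℂ} (hω : ω ^ 3 = 1)
    (h : ∀ y : ℂ, y ^ 6 = 1 → p y ∨ p (-y)) : ∃ y : ℂ, y ^ 6 = 1 ∧ p y ∧ p (ω * y) := by
  have hω6 : ω ^ 6 = 1 := by linear_combination (ω ^ 3 + 1) * hω
  have hω12 : (ω ^ 2) ^ 6 = 1 := by linear_combination (ω ^ 6 + 1) * hω6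
  have e1 : ω * ω = ω ^ 2 := by ring
  have e2 : ω * ω ^ 2 = 1 := by linear_combination hω
  by_contra! H
  have a1 := H 1 (by norm_num)
  have a2 := H (-1) (by norm_num)
  have b1 := H ω hω6
  have b2 := H (-ω) (by linear_combination hω6)
  have c1 := H (ω ^ 2) hω12
  have c2 := H (-ω ^ 2) (by linear_combination hω12)
  have h1 := h 1 (by norm_num)
  have h2 := h ω hω6
  have h3 := h (ω ^ 2) hω12
  simp only [mul_neg, mul_one, e1, e2] at a1 a2 b1 b2 c1 c2
  tauto

theorem not_coloredTrue_single {f : Ray3 → Bool} (hf : IsKSColoring (pool 6) f) (i : Fin 3) :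
    ¬ ColoredTrue f (cyclicVec i 1 0 0) := by
  intro hi
  obtain ⟨ω, hω, hω0⟩ : ∃ ω : ℂ, ω ^ 3 = 1 ∧ 1 + ω + ω ^ 2 = 0 := by
    have h := Complex.isPrimitiveRoot_exp 3 (by norm_num)
    refine ⟨_, h.pow_eq_one, ?_⟩
    simpa [Finset.sum_range_succ] using h.geom_sum_eq_zero (by norm_num)
  have hω6 : ω ^ 6 = 1 := by linear_combination (ω ^ 3 + 1) * hω
  have hωc : (starRingEnd ℂ) ω = ω ^ 2 := by
    have := conj_mul_self_of_pow_eq_one hω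
    linear_combination ω ^ 2 * this - (starRingEnd ℂ) ω * hω
  let q : ℂ → Prop := fun y => y = 0 ∨ y ^ 6 = 1
  have q0 : q 0 := .inl rfl
  have q1 : q 1 := .inr (one_pow 6)
  have hneg {y : ℂ} (hy : y ^ 6 = 1) : (-y) ^ 6 = 1 := by linear_combination hy
  have hmul {y : ℂ} (hy : y ^ 6 = 1) : (ω * y) ^ 6 = 1 := by rw [mul_pow, hω6, hy, one_mul]
  have excl {x y z x' y' z' : ℂ} (hx : q x) (hy : q y) (hz : q z) (hx' : q x') (hy' : q y')
      (hz' : q z')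
      (h : (starRingEnd ℂ) x * x' + (starRingEnd ℂ) y * y' + (starRingEnd ℂ) z * z' = 0)
      (hc : ColoredTrue f (cyclicVec i x y z)) : ¬ ColoredTrue f (cyclicVec i x' y' z') :=
    hf.not_coloredTrue (cyclicVec_coord (p := q) i hx hy hz)
      (cyclicVec_coord (p := q) i hx' hy' hz') (by rw [hermInner_cyclicVec, h]) hc
  have hy_or (y : ℂ) (hy : y ^ 6 = 1) :
      ColoredTrue f (cyclicVec i 1 y 0) ∨ ColoredTrue f (cyclicVec i 1 (-y) 0) := by
    have hc := conj_mul_self_of_pow_eq_one hy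
    refine (hf.exists_coloredTrue (cyclicVec_ne_zero i (by simp)) (cyclicVec_ne_zero i (by simp))
      (cyclicVec_ne_zero i (by simp)) (cyclicVec_coord (p := q) i q0 q0 q1)
      (cyclicVec_coord (p := q) i q1 (.inr hy) q0)
      (cyclicVec_coord (p := q) i q1 (.inr (hneg hy)) q0) ?_ ?_ ?_).resolve_left
      (excl q1 q0 q0 q0 q0 q1 (by simp) hi) <;> simp [hermInner_cyclicVec, hc]
  have hz_or (z : ℂ) (hz : z ^ 6 = 1) :
      ColoredTrue f (cyclicVec i 1 0 z) ∨ ColoredTrue f (cyclicVec i 1 0 (-z)) := by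
    have hc := conj_mul_self_of_pow_eq_one hz
    refine (hf.exists_coloredTrue (cyclicVec_ne_zero i (by simp)) (cyclicVec_ne_zero i (by simp))
      (cyclicVec_ne_zero i (by simp)) (cyclicVec_coord (p := q) i q0 q1 q0)
      (cyclicVec_coord (p := q) i q1 q0 (.inr hz))
      (cyclicVec_coord (p := q) i q1 q0 (.inr (hneg hz))) ?_ ?_ ?_).resolve_left
      (excl q1 q0 q0 q0 q1 q0 (by simp) hi) <;> simp [hermInner_cyclicVec, hc]
  have hy_excl {y z : ℂ} (hy : y ^ 6 = 1) (hz : z ^ 6 = 1)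
      (h : ColoredTrue f (cyclicVec i 1 y 0)) : ¬ ColoredTrue f (cyclicVec i 1 (-y) z) :=
    excl q1 (.inr hy) q0 q1 (.inr (hneg hy)) (.inr hz)
      (by simp [conj_mul_self_of_pow_eq_one hy]) h
  have hz_excl {y z : ℂ} (hy : y ^ 6 = 1) (hz : z ^ 6 = 1)
      (h : ColoredTrue f (cyclicVec i 1 0 z)) : ¬ ColoredTrue f (cyclicVec i 1 y (-z)) :=
    excl q1 q0 (.inr hz) q1 (.inr hy) (.inr (hneg hz))
      (by simp [conj_mul_self_of_pow_eq_one hz]) h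
  obtain ⟨y, hy, hy1, hy2⟩ := exists_and_mul_of_or_neg
    (p := fun y => ColoredTrue f (cyclicVec i 1 y 0)) hω hy_or
  obtain ⟨z, hz, hz1, hz2⟩ := exists_and_mul_of_or_neg
    (p := fun z => ColoredTrue f (cyclicVec i 1 0 z)) hω hz_or
  have hyc := conj_mul_self_of_pow_eq_one hy
  have hzc := conj_mul_self_of_pow_eq_one hz
  have hωy := hmul hy
  have hωz := hmul hz
  rcases hf.exists_coloredTrue (u := cyclicVec i 1 (-y) (-z))
    (v := cyclicVec i 1 (-(ω * y)) (-(ω * (ω * z))))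
    (w := cyclicVec i 1 (-(ω * (ω * y))) (-(ω * z)))
    (cyclicVec_ne_zero i (by simp)) (cyclicVec_ne_zero i (by simp))
    (cyclicVec_ne_zero i (by simp))
    (cyclicVec_coord (p := q) i q1 (.inr (hneg hy)) (.inr (hneg hz)))
    (cyclicVec_coord (p := q) i q1 (.inr (hneg hωy)) (.inr (hneg (hmul hωz))))
    (cyclicVec_coord (p := q) i q1 (.inr (hneg (hmul hωy))) (.inr (hneg hωz)))
    (by
      simp only [hermInner_cyclicVec, map_neg, map_one]
      linear_combination hω0 + ω * hyc + ω ^ 2 * hzc)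
    (by
      simp only [hermInner_cyclicVec, map_neg, map_one]
      linear_combination hω0 + ω ^ 2 * hyc + ω * hzc)
    (by
      simp only [hermInner_cyclicVec, map_neg, map_one, map_mul, hωc]
      linear_combination hω0 + ω ^ 4 * hyc + ω ^ 5 * hzc + (ω + ω ^ 2) * hω)
    with h | h | h
  · exact hy_excl hy (hneg hz) hy1 h
  · exact hy_excl hωy (hneg (hmul hωz)) hy2 h
  · exact hz_excl (hneg (hmul hωy)) hωz hz2 h

/-- The 6-th root-of-unity ray pool in ℂ³ is KS-uncolorable. -/
theorem stmt17 : KSUncolorable (pool 6) := by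
  rintro ⟨f, hf⟩
  have hq (i : Fin 3) : ∀ k, cyclicVec i 1 0 0 k = 0 ∨ cyclicVec i 1 0 0 k ^ 6 = 1 :=
    cyclicVec_coord (p := fun y => y = 0 ∨ y ^ 6 = 1) i (by simp) (by simp) (by simp)
  have hne (i : Fin 3) : cyclicVec i 1 0 0 ≠ 0 := cyclicVec_ne_zero i (by simp)
  have hort {i j : Fin 3} (hij : i ≠ j) :
      hermInner (cyclicVec i 1 0 0) (cyclicVec j 1 0 0) = 0 := by
    simp [hermInner, cyclicVec, hij.symm]
  rcases hf.exists_coloredTrue (hne 0) (hne 1) (hne 2) (hq 0) (hq 1) (hq 2)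
    (hort (by decide)) (hort (by decide)) (hort (by decide)) with h | h | h
  all_goals exact not_coloredTrue_single hf _ h
end

section
/- If n ≥ 1 is divisible by 6, then the n-th root-of-unity ray pool P_n is KS-uncolorable. -/
open Complex

/-- The nonzero vectors whose coordinates are zero or sixth roots of unity. -/
def IsSixthVec (v : Fin 3 → ℂ) : Prop := v ≠ 0 ∧ ∀ k, v k = 0 ∨ v k ^ 6 = 1

/-- The coloring conditions on vectors, before passing to rays. -/
def IsVecColoring (g : (Fin 3 → ℂ) → Bool) : Prop :=
  (∀ v w, IsSixthVec v → IsSixthVec w → hermInner v w = 0 → g v = true → g w = false) ∧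
  (∀ a b c, IsSixthVec a → IsSixthVec b → IsSixthVec c →
    hermInner a b = 0 → hermInner a c = 0 → hermInner b c = 0 →
      g a = true ∨ g b = true ∨ g c = true)

lemma hermInner_comp_perm (σ : Equiv.Perm (Fin 3)) (v w : Fin 3 → ℂ) :
    hermInner (v ∘ σ) (w ∘ σ) = hermInner v w :=
  Equiv.sum_comp σ fun k => (starRingEnd ℂ) (v k) * w k

lemma IsSixthVec.comp_perm {v : Fin 3 → ℂ} (hv : IsSixthVec v) (σ : Equiv.Perm (Fin 3)) :
    IsSixthVec (v ∘ σ) := by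
  refine ⟨fun h => hv.1 ?_, fun k => hv.2 (σ k)⟩
  funext k
  simpa using congrFun h (σ.symm k)

lemma IsVecColoring.comp_perm {g : (Fin 3 → ℂ) → Bool} (hg : IsVecColoring g)
    (σ : Equiv.Perm (Fin 3)) : IsVecColoring fun v => g (v ∘ σ) := by
  refine ⟨fun v w hv hw h => ?_, fun a b c ha hb hc hab hac hbc => ?_⟩
  · exact hg.1 _ _ (hv.comp_perm σ) (hw.comp_perm σ) (by rwa [hermInner_comp_perm])
  · exact hg.2 _ _ _ (ha.comp_perm σ) (hb.comp_perm σ) (hc.comp_perm σ)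
      (by rwa [hermInner_comp_perm]) (by rwa [hermInner_comp_perm])
      (by rwa [hermInner_comp_perm])

lemma hermInner_vec (a b c x y z : ℂ) :
    hermInner ![a, b, c] ![x, y, z] =
      (starRingEnd ℂ) a * x + (starRingEnd ℂ) b * y + (starRingEnd ℂ) c * z := by
  simp [hermInner, Fin.sum_univ_three]

/-- A primitive cube root of unity. -/
noncomputable def cubeRoot : ℂ := ⟨-1 / 2, Real.sqrt 3 / 2⟩

lemma cubeRoot_sq : cubeRoot ^ 2 = -1 - cubeRoot := by
  have h : Real.sqrt 3 * Real.sqrt 3 = 3 := Real.mul_self_sqrt (by norm_num)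
  apply Complex.ext <;> simp [cubeRoot, pow_two] <;> linarith

lemma conj_cubeRoot : (starRingEnd ℂ) cubeRoot = -1 - cubeRoot := by
  apply Complex.ext
  · simp [cubeRoot]; norm_num
  · simp [cubeRoot]

/-- The three cube roots of unity. -/
noncomputable def cubeRoots : Fin 3 → ℂ := ![1, cubeRoot, -1 - cubeRoot]

/-- The sixth root of unity with the given sign and cube-root index. -/
noncomputable def sixthRoot (s : Bool) (i : Fin 3) : ℂ := (if s then 1 else -1) * cubeRoots i

lemma sixthRoot_not (s : Bool) (i : Fin 3) : sixthRoot (!s) i = -sixthRoot s i := by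
  cases s <;> simp [sixthRoot]

lemma cubeRoots_pow_three (i : Fin 3) : cubeRoots i ^ 3 = 1 := by
  have h := cubeRoot_sq
  fin_cases i <;> simp [cubeRoots]
  · linear_combination (cubeRoot - 1) * h
  · linear_combination (-cubeRoot - 2) * h

lemma sixthRoot_pow_six (s : Bool) (i : Fin 3) : sixthRoot s i ^ 6 = 1 := by
  have h := cubeRoots_pow_three i
  have h' : cubeRoots i ^ 6 = 1 := by rw [show 6 = 3 * 2 from rfl, pow_mul, h, one_pow]
  cases s <;> simp [sixthRoot, h', Even.neg_pow (by decide : Even 6)]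

lemma conj_sixthRoot_mul_self (s : Bool) (i : Fin 3) :
    (starRingEnd ℂ) (sixthRoot s i) * sixthRoot s i = 1 := by
  have h := cubeRoot_sq
  cases s <;> fin_cases i <;> simp [sixthRoot, cubeRoots, conj_cubeRoot] <;>
    linear_combination -h

lemma conj_sixthRoot_mul (s : Bool) (i k : Fin 3) :
    (starRingEnd ℂ) (sixthRoot s i) * sixthRoot s (i + k) = cubeRoots k := by
  have h := cubeRoot_sq
  cases s <;> fin_cases i <;> fin_cases k <;>
    simp [sixthRoot, cubeRoots, conj_cubeRoot] <;> grind

lemma isSixthVec_of_first {a b : ℂ} (ha : a = 0 ∨ a ^ 6 = 1) (hb : b = 0 ∨ b ^ 6 = 1) :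
    IsSixthVec ![1, a, b] := by
  refine ⟨fun h => one_ne_zero (congrFun h 0), fun k => ?_⟩
  fin_cases k
  · exact Or.inr (one_pow 6)
  · exact ha
  · exact hb

lemma isSixthVec_e₂ : IsSixthVec ![0, 1, 0] :=
  ⟨fun h => one_ne_zero (congrFun h 1), fun k => by fin_cases k <;> simp⟩

lemma isSixthVec_e₃ : IsSixthVec ![0, 0, 1] :=
  ⟨fun h => one_ne_zero (congrFun h 2), fun k => by fin_cases k <;> simp⟩

/-- Among the four sign patterns, one meets each of two antipodal selections of sixth roots at
most once, so one of its three triads avoids their product. -/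
lemma exists_triad_avoiding (A B : Bool → Fin 3 → Bool)
    (hA : ∀ s i, A s i = true → A (!s) i = false)
    (hB : ∀ s i, B s i = true → B (!s) i = false) :
    ∃ s i t j, ∀ k : Fin 3, ¬(A s (i + k) = true ∧ B t (j - k) = true) := by
  have key : ∀ A : Bool → Fin 3 → Bool, (∀ s i, A s i = true → A (!s) i = false) →
      ∃ s i, ∀ k, A s k = true → k = i := by
    decide
  obtain ⟨s, a, ha⟩ := key A hA
  obtain ⟨t, b, hb⟩ := key B hB
  refine ⟨s, a, t, b + 1, fun k ⟨h₁, h₂⟩ => ?_⟩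
  exact (by decide : ∀ a b k : Fin 3, a + k = a → b + 1 - k ≠ b) a b k (ha _ h₁) (hb _ h₂)

lemma IsVecColoring.false_of_e₁ {g : (Fin 3 → ℂ) → Bool} (hg : IsVecColoring g)
    (he : g ![1, 0, 0] = true) : False := by
  have p6 := fun s i => Or.inr (a := sixthRoot s i = 0) (sixthRoot_pow_six s i)
  have z6 : (0 : ℂ) = 0 ∨ (0 : ℂ) ^ 6 = 1 := Or.inl rfl
  have he₁ := isSixthVec_of_first z6 z6
  have he₂ : g ![0, 1, 0] = false :=
    hg.1 _ _ he₁ isSixthVec_e₂ (by simp [hermInner_vec]) he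
  have he₃ : g ![0, 0, 1] = false :=
    hg.1 _ _ he₁ isSixthVec_e₃ (by simp [hermInner_vec]) he
  have hself := conj_sixthRoot_mul_self
  have hA : ∀ s i, g ![1, sixthRoot s i, 0] = true → ∀ b, b = 0 ∨ b ^ 6 = 1 →
      g ![1, sixthRoot (!s) i, b] = false := fun s i h b hb =>
    hg.1 _ _ (isSixthVec_of_first (p6 s i) z6) (isSixthVec_of_first (p6 _ i) hb)
      (by simp [hermInner_vec, sixthRoot_not, hself]) h
  have hB : ∀ s i, g ![1, 0, sixthRoot s i] = true → ∀ b, b = 0 ∨ b ^ 6 = 1 →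
      g ![1, b, sixthRoot (!s) i] = false := fun s i h b hb =>
    hg.1 _ _ (isSixthVec_of_first z6 (p6 s i)) (isSixthVec_of_first hb (p6 _ i))
      (by simp [hermInner_vec, sixthRoot_not, hself]) h
  have hA' : ∀ s i, g ![1, sixthRoot s i, 0] = true ∨ g ![1, sixthRoot (!s) i, 0] = true := by
    intro s i
    have := hg.2 _ _ _ isSixthVec_e₃ (isSixthVec_of_first (p6 s i) z6)
      (isSixthVec_of_first (p6 (!s) i) z6) (by simp [hermInner_vec]) (by simp [hermInner_vec])
      (by simp [hermInner_vec, sixthRoot_not, hself])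
    simpa [he₃] using this
  have hB' : ∀ s i, g ![1, 0, sixthRoot s i] = true ∨ g ![1, 0, sixthRoot (!s) i] = true := by
    intro s i
    have := hg.2 _ _ _ isSixthVec_e₂ (isSixthVec_of_first z6 (p6 s i))
      (isSixthVec_of_first z6 (p6 (!s) i)) (by simp [hermInner_vec]) (by simp [hermInner_vec])
      (by simp [hermInner_vec, sixthRoot_not, hself])
    simpa [he₂] using this
  obtain ⟨s, i, t, j, h⟩ := exists_triad_avoiding (fun s i => g ![1, sixthRoot s i, 0])
    (fun s i => g ![1, 0, sixthRoot s i]) (fun s i h => hA s i h 0 z6) (fun s i h => hB s i h 0 z6)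
  have hfalse : ∀ k, g ![1, sixthRoot s (i + k), sixthRoot t (j - k)] ≠ true := by
    intro k hk
    refine h k ⟨(hA' s _).resolve_right fun h' => ?_, (hB' t _).resolve_right fun h' => ?_⟩
    · have := hA _ _ h' _ (p6 t (j - k))
      simp [hk] at this
    · have := hB _ _ h' _ (p6 s (i + k))
      simp [hk] at this
  have horth : ∀ k l : Fin 3, k ≠ l →
      hermInner ![1, sixthRoot s (i + k), sixthRoot t (j - k)]
        ![1, sixthRoot s (i + l), sixthRoot t (j - l)] = 0 := by
    intro k l hkl
    rw [hermInner_vec, show i + l = (i + k) + (l - k) by abel,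
      show j - l = (j - k) + (k - l) by abel, conj_sixthRoot_mul, conj_sixthRoot_mul]
    fin_cases k <;> fin_cases l <;> simp [cubeRoots] at hkl ⊢ <;> ring
  have hv := fun k => isSixthVec_of_first (p6 s (i + k)) (p6 t (j - k))
  have := hg.2 _ _ _ (hv 0) (hv 1) (hv 2) (horth 0 1 (by decide)) (horth 0 2 (by decide))
    (horth 1 2 (by decide))
  exact this.elim (hfalse 0) (Or.rec (hfalse 1) (hfalse 2))

lemma not_isVecColoring (g : (Fin 3 → ℂ) → Bool) : ¬ IsVecColoring g := by
  intro hg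
  rcases hg.2 _ _ _ (isSixthVec_of_first (Or.inl rfl) (Or.inl rfl)) isSixthVec_e₂ isSixthVec_e₃
    (by simp [hermInner_vec]) (by simp [hermInner_vec]) (by simp [hermInner_vec]) with h | h | h
  · exact hg.false_of_e₁ h
  · refine (hg.comp_perm (Equiv.swap 0 1)).false_of_e₁ ?_
    rwa [show ![(1 : ℂ), 0, 0] ∘ Equiv.swap (0 : Fin 3) 1 = ![0, 1, 0] by
      funext k; fin_cases k <;> simp [Equiv.swap_apply_def]]
  · refine (hg.comp_perm (Equiv.swap 0 2)).false_of_e₁ ?_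
    rwa [show ![(1 : ℂ), 0, 0] ∘ Equiv.swap (0 : Fin 3) 2 = ![0, 0, 1] by
      funext k; fin_cases k <;> simp [Equiv.swap_apply_def]]

lemma mem_pool_of_isSixthVec {n : ℕ} (hn : 1 ≤ n) (h6 : 6 ∣ n) {v : Fin 3 → ℂ}
    (hv : IsSixthVec v) : Projectivization.mk ℂ v hv.1 ∈ pool n := by
  refine ⟨v, hv.1, rfl, fun k => (hv.2 k).imp_right fun h => ?_⟩
  have hn0 : n ≠ 0 := by omega
  have : NeZero n := ⟨hn0⟩
  obtain ⟨m, rfl⟩ := h6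
  obtain ⟨j, hj, hjv⟩ := (Complex.isPrimitiveRoot_exp _ hn0).eq_pow_of_pow_eq_one
    (show v k ^ (6 * m) = 1 by rw [pow_mul, h, one_pow])
  exact ⟨j, hj, hjv.symm⟩

lemma rayOrtho_mk {v w : Fin 3 → ℂ} (hv : v ≠ 0) (hw : w ≠ 0) (h : hermInner v w = 0) :
    RayOrtho (Projectivization.mk ℂ v hv) (Projectivization.mk ℂ w hw) := by
  obtain ⟨a, ha⟩ := Projectivization.exists_smul_eq_mk_rep ℂ v hv
  obtain ⟨b, hb⟩ := Projectivization.exists_smul_eq_mk_rep ℂ w hw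
  have : hermInner (a • v) (b • w) = (starRingEnd ℂ) (a : ℂ) * b * hermInner v w := by
    simp only [hermInner, Finset.mul_sum, Pi.smul_apply, Units.smul_def, smul_eq_mul, map_mul]
    exact Finset.sum_congr rfl fun k _ => by ring
  rw [RayOrtho, ← ha, ← hb, this, h, mul_zero]

/-- If 6 ∣ n then the n-th root-of-unity ray pool is KS-uncolorable. -/
theorem stmt19 (n : ℕ) (hn : 1 ≤ n) (h6 : 6 ∣ n) : KSUncolorable (pool n) := by
  classical
  rintro ⟨f, hf₁, hf₂⟩
  refine not_isVecColoring
    (fun v => if h : v ≠ 0 then f (Projectivization.mk ℂ v h) else false) ⟨?_, ?_⟩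
  · intro v w hv hw h
    simp only [dif_pos hv.1, dif_pos hw.1]
    exact hf₁ _ (mem_pool_of_isSixthVec hn h6 hv) _ (mem_pool_of_isSixthVec hn h6 hw)
      (rayOrtho_mk _ _ h)
  · intro a b c ha hb hc hab hac hbc
    have hne : ∀ {x y : Ray3}, RayOrtho x y → x ≠ y := by
      rintro x _ h rfl
      exact not_rayOrtho_self x h
    have hab := rayOrtho_mk ha.1 hb.1 hab
    have hac := rayOrtho_mk ha.1 hc.1 hac
    have hbc := rayOrtho_mk hb.1 hc.1 hbc
    simp only [dif_pos ha.1, dif_pos hb.1, dif_pos hc.1]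
    have := hf₂ _ (mem_pool_of_isSixthVec hn h6 ha) _ (mem_pool_of_isSixthVec hn h6 hb) _
      (mem_pool_of_isSixthVec hn h6 hc) (hne hab) (hne hac) (hne hbc) hab hac hbc
    tauto
end
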